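/- arXiv:math/0204132 — 12 statements merged into one kernel-verified Lean document; each statement's English description precedes it below -/
import Mathlib

section
/- Let (X,τ) be a topological space and let τ^d denote its de Groot dual, i.e., the topology on X whose closed sets are generated by taking the compact saturated subsets of (X,τ) as a closed base. Then the dual operator reverses the specialization preorder: for all x, y ∈ X, x ≤ y in the specialization preorder of (X,τ) (i.e., x ∈ cl_τ{y}) if and only if y ≤ x in the specialization preorder of (X,τ^d) (i.e., y ∈ cl_{τ^d}{x}). Equivalently, cl_{τ^d}{x} = ↑{x} = {z : z ≥ x in the specialization preorder of (X,τ)}. -/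
/-- A set is *saturated* in a topological space if it is an intersection of open sets. -/
def IsSaturatedSet {X : Type*} (t : TopologicalSpace X) (A : Set X) : Prop :=
  ∃ S : Set (Set X), (∀ U ∈ S, t.IsOpen U) ∧ A = ⋂₀ S

/-- The de Groot dual of a topology: the topology generated by taking the compact
saturated sets as a closed base (equivalently, their complements as an open subbase). -/
def deGrootDual {X : Type*} (t : TopologicalSpace X) : TopologicalSpace X :=
  TopologicalSpace.generateFrom
    {U : Set X | ∃ K : Set X, @IsCompact X t K ∧ IsSaturatedSet t K ∧ U = Kᶜ}

/-- The dual operator reverses the specialization preorder: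
x ∈ cl_τ {y} iff y ∈ cl_{τ^d} {x}. -/
theorem dual_reverses_specialization {X : Type*} [t : TopologicalSpace X] (x y : X) :
    x ∈ closure ({y} : Set X) ↔ y ∈ @closure X (deGrootDual t) ({x} : Set X) := by
  have key : y ∈ @closure X (deGrootDual t) ({x} : Set X) ↔
      ∀ U : Set X, (deGrootDual t).IsOpen U → y ∈ U → x ∈ U := by
    rw [@mem_closure_iff X (deGrootDual t)]
    simp only [Set.inter_singleton_nonempty]
    rfl
  rw [key, mem_closure_iff]
  simp only [Set.inter_singleton_nonempty]
  constructor
  · intro h U hU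
    change TopologicalSpace.GenerateOpen _ U at hU
    induction hU with
    | basic s hs =>
      obtain ⟨K, -, ⟨S, hS, rfl⟩, rfl⟩ := hs
      intro hy hx
      exact hy fun V hV => h V (hS V hV) (hx V hV)
    | univ => intro _; trivial
    | inter s u _ _ h1 h2 => exact fun hy => ⟨h1 hy.1, h2 hy.2⟩
    | sUnion S _ ih =>
      rintro ⟨s, hs, hy⟩
      exact ⟨s, hs, ih s hs hy⟩
  · intro h o ho hxo
    by_contra hyo
    have hxK : x ∈ ⋂₀ {U : Set X | IsOpen U ∧ x ∈ U} := fun U hU => hU.2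
    have hc : IsCompact (⋂₀ {U : Set X | IsOpen U ∧ x ∈ U}) := by
      apply isCompact_of_finite_subcover
      intro ι U hU hcov
      obtain ⟨i, hi⟩ := Set.mem_iUnion.1 (hcov hxK)
      refine ⟨{i}, fun z hz => ?_⟩
      simpa using hz (U i) ⟨hU i, hi⟩
    refine h (⋂₀ {U : Set X | IsOpen U ∧ x ∈ U})ᶜ ?_ ?_ hxK
    · exact TopologicalSpace.GenerateOpen.basic _ ⟨_, hc, ⟨_, fun U hU => hU.1, rfl⟩, rfl⟩
    · exact fun hy => hyo (hy o ⟨ho, hxo⟩)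
end

section
/- Let (X,τ) be a topological space. If C ⊆ X is compact in (X,τ) and P is a compact saturated subset of (X,τ^d) (i.e., P ∈ Φ^{dd}), then C ∩ P is compact in (X,τ). -/
theorem dual_open_lower {X : Type*} (t : TopologicalSpace X) (U : Set X)
    (hU : (deGrootDual t).IsOpen U) (x c : X) (hxc : x ⤳ c) (hx : x ∈ U) : c ∈ U := by
  have hU' : TopologicalSpace.GenerateOpen
    {U : Set X | ∃ K : Set X, @IsCompact X t K ∧ IsSaturatedSet t K ∧ U = Kᶜ} U := hU
  induction hU' with
  | basic s hs =>
    obtain ⟨K, -, ⟨S, hS, rfl⟩, rfl⟩ := hs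
    intro hc
    exact hx fun V hV => hxc.mem_open (hS V hV) (hc V hV)
  | univ => trivial
  | inter s u hs hu ih1 ih2 => exact ⟨ih1 hs hx.1, ih2 hu hx.2⟩
  | sUnion S hS ih =>
    obtain ⟨s, hs, hxs⟩ := hx
    exact ⟨s, hs, ih s hs (hS s hs) hxs⟩

theorem saturated_nhdsKer {X : Type*} (t : TopologicalSpace X) (A : Set X) :
    IsSaturatedSet t (nhdsKer A) := by
  refine ⟨{U | IsOpen U ∧ A ⊆ U}, fun U hU => hU.1, ?_⟩
  rw [nhdsKer_def]

/-- If C is compact in (X,τ) and P is compact saturated in (X,τ^d),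
then C ∩ P is compact in (X,τ). -/
theorem compact_inter_dd_compact {X : Type*} [t : TopologicalSpace X] (C P : Set X)
    (hC : IsCompact C)
    (hP₁ : @IsCompact X (deGrootDual t) P) (hP₂ : IsSaturatedSet (deGrootDual t) P) :
    IsCompact (C ∩ P) := by
  classical
  have low : ∀ x c : X, x ⤳ c → x ∈ P → c ∈ P := by
    obtain ⟨S, hS, rfl⟩ := hP₂
    intro x c hxc hx U hU
    exact dual_open_lower t U (hS U hU) x c hxc (hx U hU)
  apply isCompact_of_finite_subfamily_closed
  intro ι Z hZ hemp
  by_contra! hne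
  let A : Finset ι → Set X := fun u => C ∩ ⋂ i ∈ u, Z i
  have hA : ∀ u, IsCompact (A u) := fun u =>
    hC.inter_right (isClosed_biInter fun i _ => hZ i)
  have hmono : ∀ u v, u ⊆ v → A v ⊆ A u := fun u v h =>
    Set.inter_subset_inter_right _ (Set.biInter_subset_biInter_left h)
  have h1 : (P ∩ ⋂ u, nhdsKer (A u)).Nonempty := by
    refine @IsCompact.inter_iInter_nonempty X (deGrootDual t) P _ hP₁
      (fun u => nhdsKer (A u)) (fun u => ?_) (fun w => ?_)
    · refine (@isOpen_compl_iff X _ (deGrootDual t)).1 ?_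
      exact TopologicalSpace.isOpen_generateFrom_of_mem
        ⟨_, (hA u).nhdsKer, saturated_nhdsKer t _, rfl⟩
    · obtain ⟨x, ⟨hxC, hxP⟩, hx⟩ := hne (w.sup id)
      refine ⟨x, hxP, Set.mem_iInter₂.2 fun u hu => subset_nhdsKer ?_⟩
      exact hmono u (w.sup id) (Finset.le_sup (f := id) hu) ⟨hxC, hx⟩
  obtain ⟨p, hpP, hp⟩ := h1
  have h2 : ((C ∩ closure {p}) ∩ ⋂ i, Z i).Nonempty := by
    refine (hC.inter_right isClosed_closure).inter_iInter_nonempty Z hZ fun u => ?_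
    obtain ⟨c, hc, hpc⟩ := mem_nhdsKer_iff_specializes.1 (Set.mem_iInter.1 hp u)
    exact ⟨c, ⟨hc.1, hpc.mem_closure⟩, hc.2⟩
  obtain ⟨c, ⟨hcC, hcp⟩, hcZ⟩ := h2
  have : c ∈ (C ∩ P) ∩ ⋂ i, Z i :=
    ⟨⟨hcC, low p c (specializes_iff_mem_closure.2 hcp) hpP⟩, hcZ⟩
  rw [hemp] at this
  exact this
end

section
/- Let (X,τ) be a topological space, let C be a compact saturated subset of (X,τ), and let ψ be a family of compact saturated subsets of (X,τ^d) such that {C} ∪ ψ has the finite intersection property. Then one can choose for every M ∈ ψ a point ξ(M) ∈ M such that the family {C} ∪ {cl_τ{ξ(M)} : M ∈ ψ} has the finite intersection property. -/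
/-- A family of sets has the finite intersection property if every finite
subfamily has nonempty intersection. -/
def HasFIP {X : Type*} (F : Set (Set X)) : Prop :=
  ∀ G : Finset (Set X), ↑G ⊆ F → (⋂₀ (G : Set (Set X))).Nonempty

open scoped Topology

/-- Dual-compact and stable under specialization. -/
def DLow {X : Type*} (t : TopologicalSpace X) (P : Set X) : Prop :=
  @IsCompact X (deGrootDual t) P ∧ ∀ x y : X, x ⤳ y → x ∈ P → y ∈ P

/-- Dual-open sets are stable under specialization. -/
theorem dual_open_low {X : Type*} [t : TopologicalSpace X] {U : Set X}
    (hU : IsOpen[deGrootDual t] U) : ∀ x y : X, x ⤳ y → x ∈ U → y ∈ U := by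
  intro x y hxy
  induction hU with
  | basic s hs =>
    obtain ⟨K, -, ⟨S, hS, rfl⟩, rfl⟩ := hs
    intro hx hy
    exact hx fun V hV => hxy.mem_open (hS V hV) (hy V hV)
  | univ => intro _; trivial
  | inter s u _ _ h1 h2 => exact fun h => ⟨h1 h.1, h2 h.2⟩
  | sUnion S _ ih => exact fun ⟨s, hs, hx⟩ => ⟨s, hs, ih s hs hx⟩

theorem dlow_of_sat {X : Type*} [t : TopologicalSpace X] {P : Set X}
    (h1 : @IsCompact X (deGrootDual t) P) (h2 : IsSaturatedSet (deGrootDual t) P) :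
    DLow t P := by
  refine ⟨h1, ?_⟩
  obtain ⟨S, hS, rfl⟩ := h2
  intro x y hxy hx U hU
  exact dual_open_low (hS U hU) x y hxy (hx U hU)

theorem dlow_closure {X : Type*} [t : TopologicalSpace X] (a : X) :
    DLow t (closure {a}) := by
  constructor
  · intro f hf hle
    refine ⟨a, subset_closure rfl, ?_⟩
    have h : f ≤ @nhds X (deGrootDual t) a := by
      refine hle.trans ?_
      intro s hs
      obtain ⟨U, hUs, hU, haU⟩ := (@mem_nhds_iff X (deGrootDual t) a s).1 hs
      refine Filter.mem_principal.2 fun y hy => hUs ?_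
      exact dual_open_low hU a y (specializes_iff_mem_closure.2 hy) haU
    have : @nhds X (deGrootDual t) a ⊓ f = f := inf_eq_right.2 h
    have h2 : (@nhds X (deGrootDual t) a ⊓ f).NeBot := by
      rw [this]
      exact hf
    exact h2
  · intro x y hxy hx
    exact hxy.mem_closed isClosed_closure hx

theorem dual_closed_ker {X : Type*} [t : TopologicalSpace X] {A : Set X} (hA : IsCompact A) :
    IsClosed[deGrootDual t] (nhdsKer A) := by
  refine @IsClosed.mk X (deGrootDual t) _ ?_
  refine TopologicalSpace.isOpen_generateFrom_of_mem ⟨nhdsKer A, IsCompact.nhdsKer_iff.2 hA, ?_, rfl⟩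
  exact ⟨_, fun U hU => hU.1, nhdsKer_def A⟩

theorem compact_inter_dlow {X : Type*} [t : TopologicalSpace X] {C M : Set X}
    (hC : IsCompact C) (hM : DLow t M) : IsCompact (C ∩ M) := by
  classical
  apply isCompact_of_finite_subfamily_closed
  intro ι g hg he
  by_contra! hne
  have hcl : ∀ u : Finset ι, IsClosed (⋂ i ∈ u, g i) := fun u =>
    isClosed_biInter fun i _ => hg i
  obtain ⟨a, haM, ha⟩ := @IsCompact.inter_iInter_nonempty X (deGrootDual t) M (Finset ι) hM.1
    (fun u => nhdsKer (C ∩ ⋂ i ∈ u, g i))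
    (fun u => dual_closed_ker (hC.inter_right (hcl u))) (by
      intro v
      obtain ⟨x, ⟨hxC, hxM⟩, hx⟩ := hne (v.biUnion id)
      refine ⟨x, hxM, Set.mem_iInter₂.2 fun u hu => subset_nhdsKer ⟨hxC, ?_⟩⟩
      refine Set.mem_iInter₂.2 fun i hi => Set.mem_iInter₂.1 hx i ?_
      exact Finset.mem_biUnion.2 ⟨u, hu, hi⟩)
  have hK : IsCompact (C ∩ closure {a}) := hC.inter_right isClosed_closure
  obtain ⟨y, ⟨hyC, hya⟩, hy⟩ := hK.inter_iInter_nonempty g hg (by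
    intro u
    obtain ⟨y, ⟨hyC, hy⟩, hay⟩ := mem_nhdsKer_iff_specializes.1 (Set.mem_iInter.1 ha u)
    exact ⟨y, ⟨hyC, specializes_iff_mem_closure.1 hay⟩, hy⟩)
  have : y ∈ (C ∩ M) ∩ ⋂ i, g i :=
    ⟨⟨hyC, hM.2 a y (specializes_iff_mem_closure.2 hya) haM⟩, hy⟩
  rw [he] at this
  exact this

theorem compact_inter_finset {X : Type*} [t : TopologicalSpace X] {C : Set X}
    (hC : IsCompact C) (G : Finset (Set X)) (hG : ∀ M ∈ G, DLow t M) :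
    IsCompact (C ∩ ⋂₀ (G : Set (Set X))) := by
  classical
  induction G using Finset.induction_on with
  | empty => simpa using hC
  | insert M G _ ih =>
    have h := compact_inter_dlow (ih fun N hN => hG N (Finset.mem_insert_of_mem hN))
      (hG M (Finset.mem_insert_self M G))
    rw [Finset.coe_insert, Set.sInter_insert, Set.inter_comm M, ← Set.inter_assoc]
    exact h

/-- Families of dual-compact lower sets having f.i.p. together with `C`. -/
def GoodFam {X : Type*} (t : TopologicalSpace X) (C : Set X) (F : Set (Set X)) : Prop :=
  (∀ M ∈ F, DLow t M) ∧
    ∀ G : Finset (Set X), ↑G ⊆ F → (C ∩ ⋂₀ (G : Set (Set X))).Nonempty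

theorem good_step {X : Type*} [t : TopologicalSpace X] {C : Set X} {F : Set (Set X)}
    (hC : IsCompact C) (hF : GoodFam t C F) {M : Set X} (hM : M ∈ F) :
    ∃ a ∈ M, GoodFam t C (insert (closure {a}) F) := by
  classical
  obtain ⟨a, haM, ha⟩ := @IsCompact.inter_iInter_nonempty X (deGrootDual t) M
    {G : Finset (Set X) // ↑G ⊆ F} (hF.1 M hM).1
    (fun G => nhdsKer (C ∩ ⋂₀ (G.1 : Set (Set X))))
    (fun G => dual_closed_ker (compact_inter_finset hC G.1 fun N hN => hF.1 N (G.2 hN))) (by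
      intro v
      obtain ⟨x, hxC, hx⟩ := hF.2 (insert M (v.biUnion fun G => G.1)) (by
        intro N hN
        rcases Finset.mem_insert.1 hN with rfl | hN
        · exact hM
        · obtain ⟨G, _, hG⟩ := Finset.mem_biUnion.1 hN
          exact G.2 hG)
      refine ⟨x, hx M (Finset.mem_insert_self _ _),
        Set.mem_iInter₂.2 fun G hG => subset_nhdsKer ⟨hxC, fun N hN => hx N ?_⟩⟩
      exact Finset.mem_insert_of_mem (Finset.mem_biUnion.2 ⟨G, hG, hN⟩))
  refine ⟨a, haM, ?_, ?_⟩
  · rintro N (rfl | hN)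
    · exact dlow_closure a
    · exact hF.1 N hN
  · intro G hG
    obtain ⟨y, ⟨hyC, hy⟩, hay⟩ := mem_nhdsKer_iff_specializes.1
      (Set.mem_iInter.1 ha ⟨G.erase (closure {a}), by
        intro N hN
        have hN := Finset.mem_erase.1 hN
        exact (hG hN.2).resolve_left hN.1⟩)
    refine ⟨y, hyC, fun N hN => ?_⟩
    by_cases h : N = closure {a}
    · rw [h]
      exact specializes_iff_mem_closure.1 hay
    · exact hy N (Finset.mem_erase.2 ⟨h, hN⟩)

/-- Lemma 2.3: given C compact saturated in (X,τ) and ψ a family of compact saturated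
sets of (X,τ^d) with {C} ∪ ψ having f.i.p., one can choose ξ(M) ∈ M for every M ∈ ψ
such that {C} ∪ {cl_τ {ξ(M)} : M ∈ ψ} has f.i.p. -/
theorem exists_choice_fip {X : Type*} [t : TopologicalSpace X] (C : Set X) (ψ : Set (Set X))
    (hC₁ : IsCompact C) (hC₂ : IsSaturatedSet t C)
    (hψ : ∀ P ∈ ψ, @IsCompact X (deGrootDual t) P ∧ IsSaturatedSet (deGrootDual t) P)
    (hfip : HasFIP ({C} ∪ ψ)) :
    ∃ ξ : Set X → X, (∀ M ∈ ψ, ξ M ∈ M) ∧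
      HasFIP ({C} ∪ (fun M => closure ({ξ M} : Set X)) '' ψ) := by
  classical
  have h0 : GoodFam t C ψ := by
    refine ⟨fun M hM => dlow_of_sat (hψ M hM).1 (hψ M hM).2, fun G hG => ?_⟩
    have h := hfip (insert C G) (by
      intro N hN
      rcases Finset.mem_insert.1 hN with rfl | hN
      · exact Or.inl rfl
      · exact Or.inr (hG hN))
    rwa [Finset.coe_insert, Set.sInter_insert] at h
  obtain ⟨F, hψF, hF⟩ := zorn_subset_nonempty {F | GoodFam t C F} (by
    intro c hc hch hne
    refine ⟨⋃₀ c, ⟨?_, ?_⟩, fun s hs => Set.subset_sUnion_of_mem hs⟩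
    · rintro M ⟨s, hs, hM⟩
      exact (hc hs).1 M hM
    · intro G hG
      obtain ⟨s, hs, hGs⟩ := DirectedOn.exists_mem_subset_of_finset_subset_biUnion
        (f := id) hne hch.directedOn (s := G) (by simpa [Set.sUnion_eq_biUnion] using hG)
      exact (hc hs).2 G hGs) ψ h0
  have hst : ∀ M, ∃ a, M ∈ F → a ∈ M ∧ closure {a} ∈ F := by
    intro M
    by_cases hM : M ∈ F
    · obtain ⟨a, ha, hg⟩ := good_step hC₁ hF.prop hM
      exact ⟨a, fun _ => ⟨ha, hF.le_of_ge hg (Set.subset_insert _ _) (Set.mem_insert _ _)⟩⟩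
    · obtain ⟨a, -⟩ := h0.2 ∅ (by simp)
      exact ⟨a, fun h => absurd h hM⟩
  choose ξ hξ using hst
  refine ⟨ξ, fun M hM => (hξ M (hψF hM)).1, fun G hG => ?_⟩
  obtain ⟨x, hxC, hx⟩ := hF.prop.2 (G.erase C) (by
    intro N hN
    have hN := Finset.mem_erase.1 hN
    obtain ⟨M, hM, rfl⟩ := (hG hN.2).resolve_left hN.1
    exact (hξ M (hψF hM)).2)
  refine ⟨x, fun N hN => ?_⟩
  by_cases h : N = C
  · rwa [h]
  · exact hx N (Finset.mem_erase.2 ⟨h, hN⟩)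
end

section
/- For any topological space (X,τ), every compact saturated subset of (X,τ) is also a compact saturated subset of (X,τ^{dd}); that is, Φ^d ⊆ Φ^{ddd}, where Φ^d denotes the compact saturated sets of (X,τ) and Φ^{ddd} denotes the compact saturated sets of (X,τ^{dd}). -/
/-- Saturation order: `x ≤ y`. -/
def dgLe {X : Type*} (t : TopologicalSpace X) (x y : X) : Prop :=
  ∀ U : Set X, t.IsOpen U → x ∈ U → y ∈ U

theorem dg_closed_down {X : Type*} (t : TopologicalSpace X) (y : X) :
    @IsClosed X t {x | dgLe t x y} := by
  have h : {x | dgLe t x y} = closure {y} := by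
    ext x
    rw [mem_closure_iff]
    constructor
    · intro h U hU hx
      exact ⟨y, h U hU hx, rfl⟩
    · intro h U hU hx
      obtain ⟨z, hz, rfl⟩ := h U hU hx
      exact hz
  rw [h]
  exact isClosed_closure

theorem dg_sat_iff {X : Type*} (t : TopologicalSpace X) (A : Set X) :
    IsSaturatedSet t A ↔ ∀ x y, dgLe t x y → x ∈ A → y ∈ A := by
  constructor
  · rintro ⟨S, hS, rfl⟩ x y hxy hx U hU
    exact hxy U (hS U hU) (hx U hU)
  · intro h
    refine ⟨{U | t.IsOpen U ∧ A ⊆ U}, fun U hU => hU.1, ?_⟩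
    apply Set.Subset.antisymm
    · intro x hx U hU
      exact hU.2 hx
    · intro x hx
      by_contra hxA
      have := hx {z | dgLe t z x}ᶜ ⟨(dg_closed_down t x).isOpen_compl,
        fun z hz hzx => hxA (h z x hzx hz)⟩
      exact this (fun U _ h => h)

theorem dg_up_closed {X : Type*} (t : TopologicalSpace X) (L : Set X) (hL : @IsCompact X t L) :
    @IsClosed X (deGrootDual t) {y | ∃ x ∈ L, dgLe t x y} := by
  rw [← @isOpen_compl_iff]
  refine TopologicalSpace.isOpen_generateFrom_of_mem ⟨_, ?_, ?_, rfl⟩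
  · apply isCompact_of_finite_subcover
    intro ι U hU hc
    obtain ⟨s, hs⟩ := hL.elim_finite_subcover U hU
      (fun x hx => hc ⟨x, hx, fun _ _ h => h⟩)
    refine ⟨s, ?_⟩
    rintro y ⟨x, hx, hxy⟩
    have := hs hx
    simp only [Set.mem_iUnion] at this ⊢
    obtain ⟨i, hi, hxi⟩ := this
    exact ⟨i, hi, hxy _ (hU i) hxi⟩
  · rw [dg_sat_iff]
    rintro x y hxy ⟨z, hz, hzx⟩
    exact ⟨z, hz, fun U hU h => hxy U hU (hzx U hU h)⟩

theorem dg_dual_le {X : Type*} (t : TopologicalSpace X) (x y : X) :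
    dgLe (deGrootDual t) x y ↔ dgLe t y x := by
  constructor
  · intro h
    by_contra hn
    have h1 := dg_up_closed t {y} isCompact_singleton
    have := h _ h1.isOpen_compl (by
      rintro ⟨z, rfl, hz⟩
      exact hn hz)
    exact this ⟨y, rfl, fun _ _ h => h⟩
  · intro h U hU
    induction hU with
    | basic s hs =>
      obtain ⟨K, -, hK, rfl⟩ := hs
      intro hx hy
      exact hx ((dg_sat_iff t K).1 hK y x h hy)
    | univ => exact fun _ => trivial
    | inter s u _ _ h1 h2 => exact fun hx => ⟨h1 hx.1, h2 hx.2⟩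
    | sUnion S _ ih =>
      rintro ⟨s, hs, hx⟩
      exact ⟨s, hs, ih s hs hx⟩

theorem dg_pick {X ι : Type*} [Nonempty ι] (t : TopologicalSpace X) (C : Set X)
    (hC : @IsCompact X (deGrootDual t) C) (L : ι → Set X) (hL : ∀ i, @IsCompact X t (L i))
    (hd : Directed (· ⊇ ·) L) (hne : ∀ i, (C ∩ L i).Nonempty) :
    ∃ y ∈ C, ∀ i, (L i ∩ {x | dgLe t x y}).Nonempty := by
  by_contra hcon
  push Not at hcon
  obtain ⟨i, hi⟩ := @IsCompact.elim_directed_family_closed X (deGrootDual t) C ι _ hC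
    (fun i => {y | ∃ x ∈ L i, dgLe t x y}) (fun i => dg_up_closed t (L i) (hL i))
    (by
      rw [Set.eq_empty_iff_forall_notMem]
      rintro y ⟨hy, hy2⟩
      obtain ⟨i, hi⟩ := hcon y hy
      obtain ⟨x, hx, hxy⟩ := Set.mem_iInter.1 hy2 i
      exact (Set.eq_empty_iff_forall_notMem.1 hi) x ⟨hx, hxy⟩)
    (fun i j => by
      obtain ⟨k, hk1, hk2⟩ := hd i j
      exact ⟨k, fun y ⟨x, hx, h⟩ => ⟨x, hk1 hx, h⟩, fun y ⟨x, hx, h⟩ => ⟨x, hk2 hx, h⟩⟩)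
  obtain ⟨x, hx, hx2⟩ := hne i
  exact (Set.eq_empty_iff_forall_notMem.1 hi) x ⟨hx, x, hx2, fun _ _ h => h⟩

theorem dg_inter {X : Type*} (t : TopologicalSpace X) (C K : Set X)
    (hC : @IsCompact X (deGrootDual t) C) (hC2 : ∀ x y, dgLe t x y → y ∈ C → x ∈ C)
    (hK : @IsCompact X t K) : @IsCompact X t (K ∩ C) := by
  classical
  apply isCompact_of_finite_subfamily_closed
  intro ι A hA hemp
  by_contra hcon
  push Not at hcon
  obtain ⟨y, hy, hyL⟩ := dg_pick t C hC (fun u : Finset ι => K ∩ ⋂ i ∈ u, A i)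
    (fun u => hK.inter_right (isClosed_biInter fun i _ => hA i))
    (directed_of_isDirected_le fun u v h =>
      Set.inter_subset_inter_right K (Set.biInter_subset_biInter_left h))
    (fun u => by
      obtain ⟨x, hx, hx2⟩ := hcon u
      exact ⟨x, hx.2, hx.1, hx2⟩)
  obtain ⟨x, ⟨hxK, hxy⟩, hxA⟩ := (hK.inter_right (dg_closed_down t y)).inter_iInter_nonempty A hA
    (fun u => by
      obtain ⟨x, hx, hx2⟩ := hyL u
      exact ⟨x, ⟨hx.1, hx2⟩, hx.2⟩)
  exact (Set.eq_empty_iff_forall_notMem.1 hemp) x ⟨⟨hxK, hC2 x y hxy hy⟩, hxA⟩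

theorem dg_main {X ι : Type*} (t : TopologicalSpace X) (K : Set X) (C : ι → Set X)
    (hK : @IsCompact X t K)
    (hC : ∀ i, @IsCompact X (deGrootDual t) (C i))
    (hC2 : ∀ i x y, dgLe t x y → y ∈ C i → x ∈ C i)
    (hne : ∀ J : Finset ι, (K ∩ ⋂ i ∈ J, C i).Nonempty) : (K ∩ ⋂ i, C i).Nonempty := by
  classical
  have hJ : ∀ J : Finset ι, @IsCompact X t (K ∩ ⋂ i ∈ J, C i) := by
    intro J
    induction J using Finset.induction_on with
    | empty => simpa using hK
    | insert a J _ ih =>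
      have h := dg_inter t (C a) _ (hC a) (hC2 a) ih
      have e : K ∩ ⋂ i ∈ insert a J, C i = (K ∩ ⋂ i ∈ J, C i) ∩ C a := by
        rw [Finset.set_biInter_insert, Set.inter_assoc, Set.inter_comm (C a)]
      rw [e]
      exact h
  obtain ⟨A, hA⟩ := zorn_superset
    {A : Set X | IsClosed A ∧ ∀ J : Finset ι, ((K ∩ ⋂ i ∈ J, C i) ∩ A).Nonempty} (by
      intro c hc hch
      refine ⟨⋂₀ c, ⟨isClosed_sInter fun s hs => (hc hs).1, fun J => ?_⟩,
        fun s hs => Set.sInter_subset_of_mem hs⟩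
      rcases c.eq_empty_or_nonempty with rfl | hcn
      · simpa using hne J
      have : Nonempty c := hcn.to_subtype
      rw [Set.sInter_eq_iInter]
      by_contra hcon
      rw [Set.not_nonempty_iff_eq_empty] at hcon
      obtain ⟨i, hi⟩ := (hJ J).elim_directed_family_closed (fun s : c => (s : Set X))
        (fun s => (hc s.2).1) hcon (by
          intro a b
          rcases hch.total a.2 b.2 with h | h
          · exact ⟨a, subset_rfl, h⟩
          · exact ⟨b, h, subset_rfl⟩)
      exact ((hc i.2).2 J).ne_empty hi)
  obtain ⟨z, hz, hzA⟩ := hA.prop.2 ∅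
  refine ⟨z, hz.1, Set.mem_iInter.2 fun i => ?_⟩
  obtain ⟨y, hy, hyL⟩ := dg_pick t (C i) (hC i)
    (fun J : Finset ι => (K ∩ ⋂ i ∈ J, C i) ∩ A)
    (fun J => (hJ J).inter_right hA.prop.1)
    (directed_of_isDirected_le fun u v h =>
      Set.inter_subset_inter_left A
        (Set.inter_subset_inter_right K (Set.biInter_subset_biInter_left h)))
    (fun J => by
      obtain ⟨x, hx, hxA⟩ := hA.prop.2 (insert i J)
      rw [Finset.set_biInter_insert] at hx
      exact ⟨x, hx.2.1, ⟨hx.1, hx.2.2⟩, hxA⟩)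
  have hsub : A ⊆ A ∩ {x | dgLe t x y} := hA.le_of_le
    ⟨hA.prop.1.inter (dg_closed_down t y), fun J => by
      obtain ⟨x, hx, hxy⟩ := hyL J
      exact ⟨x, hx.1, hx.2, hxy⟩⟩ Set.inter_subset_left
  exact hC2 i z y (hsub hzA).2 hy

/-- Theorem 2.4: every compact saturated set of (X,τ) is compact saturated in (X,τ^{dd});
that is, Φ^d ⊆ Φ^{ddd}. -/
theorem compactSaturated_subset_ddd {X : Type*} [t : TopologicalSpace X] (K : Set X)
    (h₁ : IsCompact K) (h₂ : IsSaturatedSet t K) :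
    @IsCompact X (deGrootDual (deGrootDual t)) K ∧
      IsSaturatedSet (deGrootDual (deGrootDual t)) K := by
  constructor
  · refine @isCompact_generateFrom X (deGrootDual (deGrootDual t)) _ rfl K ?_
    intro P hP hKP
    by_contra hcon
    push Not at hcon
    obtain ⟨z, hz, hzC⟩ := dg_main t K (fun U : P => (U : Set X)ᶜ) h₁
      (fun U => by
        obtain ⟨L, hL, -, h⟩ := hP U.2
        rw [h, compl_compl]
        exact hL)
      (fun U x y hxy hy => by
        obtain ⟨L, -, hL, h⟩ := hP U.2
        rw [h, compl_compl] at hy ⊢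
        exact (dg_sat_iff _ L).1 hL y x ((dg_dual_le t y x).2 hxy) hy)
      (fun J => by
        obtain ⟨x, hx, hxn⟩ := Set.not_subset.1 (hcon (Subtype.val '' (J : Set P))
          (by rintro _ ⟨U, -, rfl⟩; exact U.2) (J.finite_toSet.image _))
        refine ⟨x, hx, ?_⟩
        simp only [Set.mem_iInter]
        intro U hU hxU
        exact hxn ⟨U, ⟨U, hU, rfl⟩, hxU⟩)
    obtain ⟨U, hU, hzU⟩ := hKP hz
    exact Set.mem_iInter.1 hzC ⟨U, hU⟩ hzU
  · rw [dg_sat_iff] at h₂ ⊢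
    intro x y hxy
    rw [dg_dual_le, dg_dual_le] at hxy
    exact h₂ x y hxy
end

section
/- For any topological space (X,τ), a subset of X is compact saturated in (X,τ^d) if and only if it is compact saturated in (X,τ^{ddd}); that is, Φ^{dd} = Φ^{dddd}. -/
/-- Finite intersection property of the family `F` relative to `D`. -/
def FipOn {X : Type*} (D : Set X) (F : Set (Set X)) : Prop :=
  ∀ G ⊆ F, G.Finite → (D ∩ ⋂₀ G).Nonempty

theorem FipOn.extend {X : Type*} {D : Set X} {F P : Set (Set X)} (hF : FipOn D F) (hFP : F ⊆ P) :
    ∃ M, F ⊆ M ∧ M ⊆ P ∧ FipOn D M ∧ ∀ A ∈ P, FipOn D (insert A M) → A ∈ M := by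
  obtain ⟨M, hFM, hM⟩ := zorn_subset_nonempty {M | M ⊆ P ∧ FipOn D M} (by
    intro c hc hchain hne
    refine ⟨⋃₀ c, ⟨Set.sUnion_subset fun s hs => (hc hs).1, ?_⟩,
      fun s hs => Set.subset_sUnion_of_mem hs⟩
    intro G hG hfin
    obtain ⟨s, hs, hGs⟩ := hchain.directedOn.exists_mem_subset_of_finite_of_subset_sUnion
      hne hfin hG
    exact (hc hs).2 G hGs hfin) F ⟨hFP, hF⟩
  refine ⟨M, hFM, hM.prop.1, hM.prop.2, fun A hA hins => ?_⟩
  exact hM.le_of_ge (y := insert A M) ⟨Set.insert_subset hA hM.prop.1, hins⟩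
    (Set.subset_insert _ _) (Set.mem_insert _ _)

theorem isCompact_of_maximal {X : Type*} [T : TopologicalSpace X] {P : Set (Set X)}
    (hT : T = TopologicalSpace.generateFrom {U | ∃ A ∈ P, U = Aᶜ}) {D : Set X}
    (h : ∀ F ⊆ P, FipOn D F → (∀ A ∈ P, FipOn D (insert A F) → A ∈ F) →
      (D ∩ ⋂₀ F).Nonempty) : IsCompact D := by
  refine isCompact_generateFrom hT fun Q hQ hcov => ?_
  by_contra! hcon
  have hfip : FipOn D {A | Aᶜ ∈ Q} := by
    intro G hG hfin
    have h1 := hcon (compl '' G) (by rintro _ ⟨A, hA, rfl⟩; exact hG hA) (hfin.image _)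
    obtain ⟨x, hx, hx'⟩ := Set.not_subset.1 h1
    refine ⟨x, hx, fun A hA => ?_⟩
    by_contra hxA
    exact hx' ⟨Aᶜ, ⟨A, hA, rfl⟩, hxA⟩
  have hsub : {A | Aᶜ ∈ Q} ⊆ P := by
    intro A hA
    obtain ⟨B, hB, hAB⟩ := hQ hA
    rwa [compl_injective hAB]
  obtain ⟨M, hFM, hMP, hM, hmax⟩ := hfip.extend hsub
  obtain ⟨x, hxD, hx⟩ := h M hMP hM hmax
  obtain ⟨U, hU, hxU⟩ := hcov hxD
  exact hx Uᶜ (hFM (by simpa using hU)) hxU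

theorem IsCompact.nonempty_of_fipOn {X : Type*} [TopologicalSpace X] {K : Set X}
    (hK : IsCompact K) {F : Set (Set X)} (hF : ∀ A ∈ F, IsClosed A) (h : FipOn K F) :
    (K ∩ ⋂₀ F).Nonempty := by
  rw [Set.sInter_eq_iInter]
  refine hK.inter_iInter_nonempty _ (fun i => hF _ i.2) fun u => ?_
  obtain ⟨x, hx, hx'⟩ := h (Subtype.val '' (u : Set F)) (by simp) (u.finite_toSet.image _)
  refine ⟨x, hx, ?_⟩
  simp only [Set.mem_iInter]
  exact fun i hi => hx' _ ⟨i, hi, rfl⟩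

theorem isSaturatedSet_iff {X : Type*} (t : TopologicalSpace X) (A : Set X) :
    IsSaturatedSet t A ↔ ∀ x y, y ∈ A → x ⤳ y → x ∈ A := by
  constructor
  · rintro ⟨S, hS, rfl⟩ x y hy hxy U hU
    exact hxy.mem_open (hS U hU) (hy U hU)
  · intro h
    refine ⟨{U | IsOpen U ∧ A ⊆ U}, fun U hU => hU.1, ?_⟩
    rw [← nhdsKer_def]
    refine subset_nhdsKer.antisymm fun x hx => ?_
    obtain ⟨y, hy, hxy⟩ := mem_nhdsKer_iff_specializes.1 hx
    exact h x y hy hxy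

theorem isSaturatedSet_nhdsKer {X : Type*} [t : TopologicalSpace X] (A : Set X) :
    IsSaturatedSet t (nhdsKer A) :=
  ⟨_, fun _ hU => hU.1, nhdsKer_def A⟩

theorem isClosed_dual {X : Type*} {t : TopologicalSpace X} {K : Set X} (hK : IsCompact K)
    (hs : IsSaturatedSet t K) : @IsClosed X (deGrootDual t) K := by
  rw [← @isOpen_compl_iff]
  exact TopologicalSpace.isOpen_generateFrom_of_mem ⟨K, hK, hs, rfl⟩

theorem specializes_dual {X : Type*} (t : TopologicalSpace X) (x y : X) :
    @Specializes X (deGrootDual t) x y ↔ @Specializes X t y x := by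
  constructor
  · intro h
    have hc : @IsClosed X (deGrootDual t) (nhdsKer {x}) :=
      isClosed_dual (IsCompact.nhdsKer_iff.2 isCompact_singleton) (isSaturatedSet_nhdsKer _)
    exact mem_nhdsKer_singleton.1
      (@Specializes.mem_closed X (deGrootDual t) _ _ _ h hc (subset_nhdsKer rfl))
  · intro h
    rw [@specializes_iff_pure, deGrootDual, TopologicalSpace.nhds_generateFrom]
    simp only [le_iInf_iff]
    rintro s ⟨hy, K, hK, hs, rfl⟩
    simp only [Filter.le_principal_iff, Filter.mem_pure]
    exact fun hx => hy ((isSaturatedSet_iff t K).1 hs y x hx h)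

theorem saturated_dual_iff {X : Type*} (t : TopologicalSpace X) (A : Set X) :
    IsSaturatedSet (deGrootDual t) A ↔ ∀ x y, y ∈ A → y ⤳ x → x ∈ A := by
  simp only [isSaturatedSet_iff, specializes_dual]

theorem saturated_dual_dual_iff {X : Type*} (t : TopologicalSpace X) (A : Set X) :
    IsSaturatedSet (deGrootDual (deGrootDual t)) A ↔ IsSaturatedSet t A := by
  simp only [isSaturatedSet_iff, specializes_dual]

/-- Key step. -/
theorem exists_point {X : Type*} [t : TopologicalSpace X] {E L : Set X} {F : Set (Set X)}
    (hL : @IsCompact X (deGrootDual t) L)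
    (hEF : ∀ G ⊆ F, G.Finite → IsCompact (E ∩ ⋂₀ G)) (hfip : FipOn (E ∩ L) F) :
    ∃ c ∈ L, FipOn (E ∩ closure {c}) F := by
  obtain ⟨c, hcL, hc⟩ := @IsCompact.inter_iInter_nonempty X (deGrootDual t) L
    {G : Set (Set X) // G ⊆ F ∧ G.Finite} hL (fun G => nhdsKer (E ∩ ⋂₀ G.1))
    (fun G => isClosed_dual (IsCompact.nhdsKer_iff.2 (hEF G.1 G.2.1 G.2.2))
      (isSaturatedSet_nhdsKer _)) (by
    intro u
    obtain ⟨x, hx, hx'⟩ := hfip (⋃ G ∈ u, G.1) (by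
      simp only [Set.iUnion_subset_iff]; exact fun G _ => G.2.1)
      (u.finite_toSet.biUnion fun G _ => G.2.2)
    refine ⟨x, hx.2, ?_⟩
    simp only [Set.mem_iInter]
    intro G hG
    refine subset_nhdsKer ⟨hx.1, fun A hA => hx' A ?_⟩
    simp only [Set.mem_iUnion]
    exact ⟨G, hG, hA⟩)
  refine ⟨c, hcL, fun G hG hfin => ?_⟩
  obtain ⟨e, he, hce⟩ := mem_nhdsKer_iff_specializes.1 (Set.mem_iInter.1 hc ⟨G, hG, hfin⟩)
  exact ⟨e, ⟨he.1, hce.mem_closure⟩, he.2⟩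

theorem FipOn.insert_of_inter {X : Type*} {D A : Set X} {F : Set (Set X)}
    (h : FipOn (D ∩ A) F) : FipOn D (insert A F) := by
  intro G hG hfin
  obtain ⟨x, hx, hx'⟩ := h (G \ {A}) (by
    rintro B ⟨hB, hBA⟩
    exact (hG hB).resolve_left hBA) (hfin.subset Set.diff_subset)
  refine ⟨x, hx.1, fun B hB => ?_⟩
  by_cases hBA : B = A
  · exact hBA ▸ hx.2
  · exact hx' B ⟨hB, hBA⟩

theorem FipOn.mono {X : Type*} {D D' : Set X} {F F' : Set (Set X)}
    (h : FipOn D F) (hD : D ⊆ D') (hF : F' ⊆ F) : FipOn D' F' :=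
  fun G hG hfin => (h G (hG.trans hF) hfin).mono (Set.inter_subset_inter_left _ hD)

theorem FipOn.inter_of_mem {X : Type*} {D A : Set X} {F : Set (Set X)}
    (h : FipOn D F) (hA : A ∈ F) : FipOn (D ∩ A) F := by
  intro G hG hfin
  obtain ⟨x, hx, hx'⟩ := h (insert A G) (Set.insert_subset hA hG) (hfin.insert A)
  exact ⟨x, ⟨hx, hx' A (Set.mem_insert _ _)⟩, fun B hB => hx' B (Set.mem_insert_of_mem _ hB)⟩

theorem closure_subset_of_saturated_dual {X : Type*} [t : TopologicalSpace X] {L : Set X}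
    (hs : IsSaturatedSet (deGrootDual t) L) {c : X} (hc : c ∈ L) : closure {c} ⊆ L :=
  fun x hx => (saturated_dual_iff t L).1 hs x c hc (specializes_iff_mem_closure.2 hx)

theorem isCompact_inter_dual {X : Type*} [t : TopologicalSpace X] {E L : Set X}
    (hE : IsCompact E) (hL : @IsCompact X (deGrootDual t) L)
    (hs : IsSaturatedSet (deGrootDual t) L) : IsCompact (E ∩ L) := by
  refine isCompact_of_maximal (P := {A | IsClosed A}) ?_ ?_
  · conv_lhs => rw [← TopologicalSpace.generateFrom_setOf_isOpen t]
    congr 1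
    ext U
    constructor
    · intro hU
      exact ⟨Uᶜ, isClosed_compl_iff.2 hU, (compl_compl U).symm⟩
    · rintro ⟨A, hA, rfl⟩
      exact isOpen_compl_iff.2 hA
  · intro F hF hfip hmax
    obtain ⟨c, hcL, hc⟩ := exists_point hL (E := E) (F := F)
      (fun G hG _ => hE.inter_right (isClosed_sInter fun A hA => hF (hG hA))) hfip
    have hcl := closure_subset_of_saturated_dual hs hcL
    have hmem : closure {c} ∈ F := hmax _ isClosed_closure
      (hc.mono (D' := E ∩ L ∩ closure {c}) (fun x hx => ⟨⟨hx.1, hcl hx.2⟩, hx.2⟩)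
        subset_rfl).insert_of_inter
    obtain ⟨x, hx, hx'⟩ := hE.nonempty_of_fipOn (fun A hA => hF hA)
      (hfip.mono Set.inter_subset_left subset_rfl)
    exact ⟨x, ⟨hx, hcl (hx' _ hmem)⟩, hx'⟩

theorem isCompact_dual_dual {X : Type*} [t : TopologicalSpace X] {E : Set X}
    (hE : IsCompact E) : @IsCompact X (deGrootDual (deGrootDual t)) E := by
  refine @isCompact_of_maximal X (deGrootDual (deGrootDual t))
    {L | @IsCompact X (deGrootDual t) L ∧ IsSaturatedSet (deGrootDual t) L} ?_ E ?_
  · simp only [deGrootDual, Set.mem_setOf_eq, and_assoc]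
  · intro F hF hfip hmax
    have hcomp : ∀ G ⊆ F, G.Finite → IsCompact (E ∩ ⋂₀ G) := by
      intro G hG hfin
      induction G, hfin using Set.Finite.induction_on with
      | empty => simpa using hE
      | @insert A G _ _ ih =>
        have h1 := hF (hG (Set.mem_insert A G))
        have h2 := isCompact_inter_dual (ih ((Set.subset_insert _ _).trans hG)) h1.1 h1.2
        rwa [Set.inter_assoc, Set.inter_comm _ A, ← Set.sInter_insert] at h2
    have key : ∀ L ∈ F, ∃ c ∈ L, closure {c} ∈ F := by
      intro L hL
      obtain ⟨c, hcL, hc⟩ := exists_point (hF hL).1 hcomp (hfip.inter_of_mem hL)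
      refine ⟨c, hcL, hmax _ ?_ hc.insert_of_inter⟩
      have : closure {c} = @nhdsKer X (deGrootDual t) {c} := by
        ext x
        rw [@mem_nhdsKer_singleton X (deGrootDual t), specializes_dual,
          specializes_iff_mem_closure]
      rw [this]
      exact ⟨(@IsCompact.nhdsKer_iff X (deGrootDual t) _).2
        (@isCompact_singleton X (deGrootDual t) c), @isSaturatedSet_nhdsKer X (deGrootDual t) _⟩
    obtain ⟨x, hx, hx'⟩ := hE.nonempty_of_fipOn (F := {A | A ∈ F ∧ IsClosed A})
      (fun A hA => hA.2) (hfip.mono subset_rfl fun A hA => hA.1)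
    refine ⟨x, hx, fun L hL => ?_⟩
    obtain ⟨c, hcL, hc⟩ := key L hL
    exact closure_subset_of_saturated_dual (hF hL).2 hcL (hx' _ ⟨hc, isClosed_closure⟩)

theorem dual_le_triple {X : Type*} (t : TopologicalSpace X) :
    deGrootDual (deGrootDual (deGrootDual t)) ≤ deGrootDual t := by
  refine le_generateFrom ?_
  rintro U ⟨K, hK, hs, rfl⟩
  exact TopologicalSpace.isOpen_generateFrom_of_mem
    ⟨K, isCompact_dual_dual hK, (saturated_dual_dual_iff t K).2 hs, rfl⟩

/-- Corollary 2.5: Φ^{dd} = Φ^{dddd}; a set is compact saturated in (X,τ^d) iff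
it is compact saturated in (X,τ^{ddd}). -/
theorem compactSaturated_dd_eq_dddd {X : Type*} [t : TopologicalSpace X] (K : Set X) :
    (@IsCompact X (deGrootDual t) K ∧ IsSaturatedSet (deGrootDual t) K) ↔
      (@IsCompact X (deGrootDual (deGrootDual (deGrootDual t))) K ∧
        IsSaturatedSet (deGrootDual (deGrootDual (deGrootDual t))) K) := by
  rw [saturated_dual_dual_iff (deGrootDual t)]
  refine and_congr_left fun _ => ⟨fun h => @isCompact_dual_dual X (deGrootDual t) K h, fun h => ?_⟩
  have := @IsCompact.image X X (deGrootDual (deGrootDual (deGrootDual t))) (deGrootDual t) K id h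
    (continuous_id_of_le (dual_le_triple t))
  simpa using this
end

section
/- For any topological space (X,τ), the second dual topology coincides with the fourth dual topology: τ^{dd} = τ^{dddd}. In particular, the process of taking de Groot duals of any topological space terminates after finitely many steps with topologies that are duals of each other. -/
namespace DeGroot

/-- The specialization preorder: `x ≤ y` iff every open set containing `x` contains `y`. -/
def le {X : Type*} (t : TopologicalSpace X) (x y : X) : Prop :=
  ∀ U, t.IsOpen U → x ∈ U → y ∈ U

theorem le_rfl' {X : Type*} (t : TopologicalSpace X) (x : X) : le t x x := fun _ _ h => h

theorem le_trans' {X : Type*} {t : TopologicalSpace X} {x y z : X}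
    (h : le t x y) (h' : le t y z) : le t x z := fun U hU hx => h' U hU (h U hU hx)

theorem sat_iff {X : Type*} (t : TopologicalSpace X) (A : Set X) :
    IsSaturatedSet t A ↔ ∀ x ∈ A, ∀ y, le t x y → y ∈ A := by
  constructor
  · rintro ⟨S, hS, rfl⟩ x hx y hxy U hU
    exact hxy U (hS U hU) (hx U hU)
  · intro h
    refine ⟨{U | t.IsOpen U ∧ A ⊆ U}, fun U hU => hU.1, ?_⟩
    apply Set.Subset.antisymm
    · intro x hx U hU
      exact hU.2 hx
    · intro y hy
      by_contra hyA
      have h1 : ∀ x : A, ∃ U, t.IsOpen U ∧ x.1 ∈ U ∧ y ∉ U := by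
        intro x
        by_contra hc
        apply hyA
        apply h x.1 x.2
        intro U hU hx
        by_contra hyU
        exact hc ⟨U, hU, hx, hyU⟩
      choose U hU hxU hyU using h1
      have h2 : y ∈ ⋃ x, U x := by
        apply hy
        refine ⟨?_, fun x hx => Set.mem_iUnion.2 ⟨⟨x, hx⟩, hxU ⟨x, hx⟩⟩⟩
        exact @isOpen_iUnion X A t U hU
      obtain ⟨x, hx⟩ := Set.mem_iUnion.1 h2
      exact hyU x hx

/-- Upward closure. -/
def up {X : Type*} (t : TopologicalSpace X) (A : Set X) : Set X := {y | ∃ x ∈ A, le t x y}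

theorem up_sat {X : Type*} (t : TopologicalSpace X) (A : Set X) : IsSaturatedSet t (up t A) := by
  rw [sat_iff]
  rintro x ⟨a, ha, hax⟩ y hxy
  exact ⟨a, ha, le_trans' hax hxy⟩

theorem up_compact {X : Type*} (t : TopologicalSpace X) {A : Set X} (hA : @IsCompact X t A) :
    @IsCompact X t (up t A) := by
  apply @isCompact_of_finite_subcover X t
  intro ι U hU hs
  obtain ⟨v, hv⟩ := @IsCompact.elim_finite_subcover X t A ι hA U hU
    (fun a ha => hs ⟨a, ha, le_rfl' t a⟩)
  refine ⟨v, ?_⟩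
  rintro y ⟨a, ha, hay⟩
  obtain ⟨i, hi, hai⟩ := Set.mem_iUnion₂.1 (hv ha)
  exact Set.mem_iUnion₂.2 ⟨i, hi, hay _ (hU i) hai⟩

theorem closed_dual {X : Type*} (t : TopologicalSpace X) {K : Set X} (hK : @IsCompact X t K)
    (hs : IsSaturatedSet t K) : @IsClosed X (deGrootDual t) K := by
  apply @IsClosed.mk X (deGrootDual t)
  exact TopologicalSpace.GenerateOpen.basic _ ⟨K, hK, hs, rfl⟩

theorem up_closed {X : Type*} (t : TopologicalSpace X) {A : Set X} (hA : @IsCompact X t A) :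
    @IsClosed X (deGrootDual t) (up t A) :=
  closed_dual t (up_compact t hA) (up_sat t A)

theorem le_dual {X : Type*} (t : TopologicalSpace X) (x y : X) :
    le (deGrootDual t) x y ↔ le t y x := by
  constructor
  · intro h
    by_contra hc
    have hcl := up_closed t (@isCompact_singleton X t y)
    have := h _ hcl.isOpen_compl (by
      rintro ⟨a, rfl, ha⟩
      exact hc ha)
    exact this ⟨y, rfl, le_rfl' t y⟩
  · intro h U hU
    induction hU with
    | basic s hs =>
      obtain ⟨K, -, hK, rfl⟩ := hs
      intro hx hy
      exact hx ((sat_iff t K).1 hK y hy x h)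
    | univ => intro _; trivial
    | inter s u _ _ h1 h2 => exact fun hx => ⟨h1 hx.1, h2 hx.2⟩
    | sUnion S _ ih =>
      rintro ⟨s, hs, hx⟩
      exact ⟨s, hs, ih s hs hx⟩

theorem down_closed {X : Type*} (t : TopologicalSpace X) (x : X) :
    @IsClosed X t {y | le t y x} := by
  have : {y | le t y x} = @closure X t {x} := by
    ext y
    rw [@mem_closure_iff X t]
    constructor
    · intro h U hU hy
      exact ⟨x, h U hU hy, rfl⟩
    · intro h U hU hy
      obtain ⟨z, hz, rfl⟩ := h U hU hy
      exact hz
  rw [this]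
  exact @isClosed_closure X t {x}

theorem inter_compact {X : Type*} (t : TopologicalSpace X) {N D : Set X}
    (hN : @IsCompact X t N) (hD : @IsCompact X (deGrootDual t) D)
    (hl : ∀ x ∈ D, ∀ y, le t y x → y ∈ D) : @IsCompact X t (N ∩ D) := by
  classical
  apply @isCompact_of_finite_subfamily_closed X t
  intro ι Z hZ hem
  by_contra! hc
  have hNZ : ∀ u : Finset ι, @IsCompact X t (N ∩ ⋂ i ∈ u, Z i) := fun u =>
    @IsCompact.inter_right X t _ _ hN (@isClosed_biInter X ι t _ _ (fun i _ => hZ i))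
  obtain ⟨x, hxD, hx⟩ := @IsCompact.inter_iInter_nonempty X (deGrootDual t) D _ hD
    (fun u : Finset ι => up t (N ∩ ⋂ i ∈ u, Z i)) (fun u => up_closed t (hNZ u)) (by
      intro v
      obtain ⟨z, ⟨hzN, hzD⟩, hz⟩ := hc (v.sup id)
      refine ⟨z, hzD, Set.mem_iInter₂.2 fun u hu => ⟨z, ⟨hzN, ?_⟩, le_rfl' t z⟩⟩
      refine Set.mem_iInter₂.2 fun i hi => Set.mem_iInter₂.1 hz i ?_
      exact Finset.le_sup (f := id) hu hi)
  have hNx : @IsCompact X t (N ∩ {y | le t y x}) :=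
    @IsCompact.inter_right X t _ _ hN (down_closed t x)
  obtain ⟨y, ⟨hyN, hyx⟩, hy⟩ := @IsCompact.inter_iInter_nonempty X t _ _ hNx Z hZ (by
      intro u
      obtain ⟨a, ⟨haN, ha⟩, hax⟩ := Set.mem_iInter.1 hx u
      exact ⟨a, ⟨haN, hax⟩, ha⟩)
  have : y ∈ (N ∩ D) ∩ ⋂ i, Z i := ⟨⟨hyN, hl x hxD y hyx⟩, hy⟩
  rw [hem] at this
  exact this

theorem key {X : Type*} (t : TopologicalSpace X) {K : Set X} (hK : @IsCompact X t K)
    {ι : Type*} (E : ι → Set X) (hE : ∀ i, @IsCompact X (deGrootDual t) (E i))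
    (hl : ∀ i, ∀ x ∈ E i, ∀ y, le t y x → y ∈ E i)
    (hne : ∀ u : Finset ι, (K ∩ ⋂ i ∈ u, E i).Nonempty) : (K ∩ ⋂ i, E i).Nonempty := by
  classical
  have hM : ∀ u : Finset ι, @IsCompact X t (K ∩ ⋂ i ∈ u, E i) := by
    intro u
    induction u using Finset.induction_on with
    | empty => simpa using hK
    | insert a u _ ih =>
      have := inter_compact t ih (hE a) (hl a)
      rw [Finset.set_biInter_insert, Set.inter_comm (E a), ← Set.inter_assoc]
      exact this
  obtain ⟨A, hA⟩ := zorn_superset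
    {A : Set X | @IsClosed X t A ∧ ∀ u : Finset ι, ((K ∩ ⋂ i ∈ u, E i) ∩ A).Nonempty} (by
      intro c hcS hc
      refine ⟨⋂₀ c, ⟨@isClosed_sInter X t c fun s hs => (hcS hs).1, ?_⟩,
        fun s hs => Set.sInter_subset_of_mem hs⟩
      intro u
      rcases c.eq_empty_or_nonempty with rfl | ⟨a0, ha0⟩
      · simpa using hne u
      rw [Set.sInter_eq_iInter]
      apply @IsCompact.inter_iInter_nonempty X t _ _ (hM u)
      · exact fun i => (hcS i.2).1
      · intro v
        have : ∃ a ∈ c, a ⊆ ⋂ i ∈ v, (i : Set X) := by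
          induction v using Finset.induction_on with
          | empty => exact ⟨a0, ha0, by simp⟩
          | insert b v _ ih =>
            obtain ⟨a, ha, hav⟩ := ih
            rw [Finset.set_biInter_insert]
            rcases hc.total ha b.2 with h | h
            · exact ⟨a, ha, Set.subset_inter h hav⟩
            · exact ⟨b, b.2, Set.subset_inter subset_rfl (h.trans hav)⟩
        obtain ⟨a, ha, hav⟩ := this
        exact ((hcS ha).2 u).mono (Set.inter_subset_inter_right _ hav))
  obtain ⟨hAc, hAne⟩ := hA.prop
  have hsub : ∀ j, A ⊆ E j := by
    intro j
    obtain ⟨x, hxj, hx⟩ := @IsCompact.inter_iInter_nonempty X (deGrootDual t) (E j) _ (hE j)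
      (fun u : Finset ι => up t ((K ∩ ⋂ i ∈ u, E i) ∩ A))
      (fun u => up_closed t (@IsCompact.inter_right X t _ _ (hM u) hAc)) (by
        intro v
        obtain ⟨z, ⟨hzK, hz⟩, hzA⟩ := hAne (insert j (v.sup id))
        have hz' := Set.mem_iInter₂.1 hz
        refine ⟨z, hz' j (Finset.mem_insert_self _ _), Set.mem_iInter₂.2 fun u hu =>
          ⟨z, ⟨⟨hzK, ?_⟩, hzA⟩, le_rfl' t z⟩⟩
        refine Set.mem_iInter₂.2 fun i hi => hz' i (Finset.mem_insert_of_mem ?_)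
        exact Finset.le_sup (f := id) hu hi)
    have hmem : A ∩ {y | le t y x} ∈ {A : Set X | @IsClosed X t A ∧
        ∀ u : Finset ι, ((K ∩ ⋂ i ∈ u, E i) ∩ A).Nonempty} := by
      refine ⟨@IsClosed.inter X _ _ t hAc (down_closed t x), fun u => ?_⟩
      obtain ⟨a, ⟨ha, haA⟩, hax⟩ := Set.mem_iInter.1 hx u
      exact ⟨a, ha, haA, hax⟩
    intro y hy
    exact hl j x hxj y (hA.le_of_le hmem Set.inter_subset_left hy).2
  obtain ⟨z, ⟨hzK, -⟩, hzA⟩ := hAne ∅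
  exact ⟨z, hzK, Set.mem_iInter.2 fun j => hsub j hzA⟩

theorem compact_dd {X : Type*} (t : TopologicalSpace X) {K : Set X} (hK : @IsCompact X t K) :
    @IsCompact X (deGrootDual (deGrootDual t)) K := by
  classical
  apply @isCompact_generateFrom X (deGrootDual (deGrootDual t)) _ rfl
  intro P hP hcov
  by_contra! hc
  obtain ⟨z, hzK, hz⟩ := key t hK (fun i : P => (i.1)ᶜ)
    (by
      rintro ⟨U, hU⟩
      obtain ⟨D, hD, -, rfl⟩ := hP hU
      simpa using hD)
    (by
      rintro ⟨U, hU⟩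
      obtain ⟨D, -, hD, rfl⟩ := hP hU
      intro x hx y hyx
      simp only [compl_compl] at hx ⊢
      exact (sat_iff _ D).1 hD x hx y ((le_dual t x y).2 hyx))
    (by
      intro u
      have := hc (Subtype.val '' (u : Set P)) (by rintro _ ⟨i, -, rfl⟩; exact i.2)
        (u.finite_toSet.image _)
      obtain ⟨z, hzK, hz⟩ := Set.not_subset.1 this
      refine ⟨z, hzK, Set.mem_iInter₂.2 fun i hi hzi => hz ?_⟩
      exact ⟨i.1, ⟨i, hi, rfl⟩, hzi⟩)
  obtain ⟨U, hU, hzU⟩ := hcov hzK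
  exact Set.mem_iInter.1 hz ⟨U, hU⟩ hzU

theorem sat_dd {X : Type*} (t : TopologicalSpace X) (K : Set X) :
    IsSaturatedSet (deGrootDual (deGrootDual t)) K ↔ IsSaturatedSet t K := by
  simp only [sat_iff, le_dual]

/-- `τ^d ⊆ τ^{ddd}` (in Mathlib's order on topologies, finer is smaller). -/
theorem ddd_le {X : Type*} (t : TopologicalSpace X) :
    deGrootDual (deGrootDual (deGrootDual t)) ≤ deGrootDual t := by
  apply TopologicalSpace.generateFrom_anti
  rintro U ⟨K, hK, hs, rfl⟩
  exact ⟨K, compact_dd t hK, (sat_dd t K).2 hs, rfl⟩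

end DeGroot

/-- Corollary 2.6: for any topological space, τ^{dd} = τ^{dddd}. -/
theorem dual_dual_eq_dual_dual_dual_dual {X : Type*} (t : TopologicalSpace X) :
    deGrootDual (deGrootDual t) =
      deGrootDual (deGrootDual (deGrootDual (deGrootDual t))) := by
  apply le_antisymm
  · apply TopologicalSpace.generateFrom_anti
    rintro U ⟨K, hK, hs, rfl⟩
    refine ⟨K, ?_, (DeGroot.sat_dd _ K).1 hs, rfl⟩
    have h := @IsCompact.image X X (deGrootDual (deGrootDual (deGrootDual t))) (deGrootDual t)
      K id hK (continuous_id_of_le (DeGroot.ddd_le t))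
    rwa [Set.image_id] at h
  · exact DeGroot.ddd_le (deGrootDual t)
end

section
/- For any topological space (X,τ): τ^{ddd} = τ if and only if τ^d = τ. (In the paper's notation, the classes G_1 and G_{3a} coincide.) -/
/-- `y` lies in every open set containing `x`. -/
def SpecR {X : Type*} (t : TopologicalSpace X) (x y : X) : Prop :=
  ∀ U : Set X, t.IsOpen U → x ∈ U → y ∈ U

theorem sat_iff {X : Type*} (t : TopologicalSpace X) (A : Set X) :
    IsSaturatedSet t A ↔ ∀ x ∈ A, ∀ y, SpecR t x y → y ∈ A := by
  constructor
  · rintro ⟨S, hS, rfl⟩ x hx y hxy U hU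
    exact hxy U (hS U hU) (hx U hU)
  · intro h
    refine ⟨{U | t.IsOpen U ∧ A ⊆ U}, fun U hU => hU.1, ?_⟩
    apply Set.Subset.antisymm
    · exact fun x hx U hU => hU.2 hx
    · intro y hy
      by_contra hyA
      have h1 : ∀ x ∈ A, ∃ U, t.IsOpen U ∧ x ∈ U ∧ y ∉ U := by
        intro x hx
        by_contra hc
        push Not at hc
        exact hyA (h x hx y hc)
      have h2 : t.IsOpen (⋃₀ {U | t.IsOpen U ∧ y ∉ U}) :=
        t.isOpen_sUnion _ (fun U hU => hU.1)
      have h3 := hy (⋃₀ {U | t.IsOpen U ∧ y ∉ U}) ⟨h2, fun x hx => by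
        obtain ⟨U, hU, hxU, hyU⟩ := h1 x hx
        exact ⟨U, ⟨hU, hyU⟩, hxU⟩⟩
      obtain ⟨U, ⟨_, hyU⟩, hyU'⟩ := h3
      exact hyU hyU'

theorem open_dual {X : Type*} (t : TopologicalSpace X) {K : Set X}
    (hK : @IsCompact X t K) (hs : IsSaturatedSet t K) :
    (deGrootDual t).IsOpen Kᶜ :=
  TopologicalSpace.GenerateOpen.basic _ ⟨K, hK, hs, rfl⟩

theorem specR_dual {X : Type*} (t : TopologicalSpace X) (x y : X) :
    SpecR (deGrootDual t) x y ↔ SpecR t y x := by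
  constructor
  · intro h
    have hc : @IsCompact X t {z | SpecR t y z} := by
      letI := t
      rw [isCompact_iff_finite_subcover]
      intro ι U hU hcov
      obtain ⟨i, hi⟩ := Set.mem_iUnion.1 (hcov (show SpecR t y y from fun _ _ h => h))
      refine ⟨{i}, fun z hz => ?_⟩
      simpa using hz (U i) (hU i) hi
    have hs : IsSaturatedSet t {z | SpecR t y z} := by
      rw [sat_iff]
      exact fun a ha b hab U hU hyU => hab U hU (ha U hU hyU)
    by_contra hx
    exact h _ (open_dual t hc hs) hx (fun _ _ h => h)
  · intro h U hU
    induction hU with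
    | basic s hs =>
      obtain ⟨K, -, hK, rfl⟩ := hs
      exact fun hx hy => hx ((sat_iff t K).1 hK y hy x h)
    | univ => exact fun _ => trivial
    | inter s u _ _ h1 h2 => exact fun hx => ⟨h1 hx.1, h2 hx.2⟩
    | sUnion S _ ih =>
      rintro ⟨s, hs, hx⟩
      exact ⟨s, hs, ih s hs hx⟩

theorem sat_dual {X : Type*} (t : TopologicalSpace X)
    (hR : ∀ x y, SpecR t x y → SpecR t y x) (A : Set X) :
    IsSaturatedSet (deGrootDual t) A ↔ IsSaturatedSet t A := by
  simp only [sat_iff, specR_dual]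
  exact ⟨fun h x hx y hy => h x hx y (hR _ _ hy), fun h x hx y hy => h x hx y (hR _ _ hy)⟩

theorem sat_inter {X : Type*} (t : TopologicalSpace X) {A B : Set X}
    (hA : IsSaturatedSet t A) (hB : IsSaturatedSet t B) : IsSaturatedSet t (A ∩ B) := by
  rw [sat_iff] at *
  exact fun x hx y hy => ⟨hA x hx.1 y hy, hB x hx.2 y hy⟩

theorem compact_inter_dual {X : Type*} (t : TopologicalSpace X)
    (hR : ∀ x y, SpecR t x y → SpecR t y x) {K M : Set X}
    (hK : @IsCompact X t K) (hKs : IsSaturatedSet t K)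
    (hM : @IsCompact X (deGrootDual t) M) : @IsCompact X t (K ∩ M) := by
  refine (@isCompact_iff_finite_subcover X t (K ∩ M)).2 ?_
  intro ι U hU hcov
  by_cases hι : Nonempty ι
  · have hop : ∀ i, (deGrootDual t).IsOpen (K ∩ (U i)ᶜ)ᶜ := by
      intro i
      apply open_dual
      · exact @IsCompact.inter_right X t _ _ hK (@isClosed_compl_iff X t _ |>.2 (hU i))
      · apply sat_inter t hKs
        rw [sat_iff]
        exact fun x hx y hxy hy => hx (hR _ _ hxy _ (hU i) hy)
    obtain ⟨s, hs⟩ := (@isCompact_iff_finite_subcover X (deGrootDual t) M).1 hM _ hop (by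
      intro m hm
      by_cases hmK : m ∈ K
      · obtain ⟨i, hi⟩ := Set.mem_iUnion.1 (hcov ⟨hmK, hm⟩)
        exact Set.mem_iUnion.2 ⟨i, fun h => h.2 hi⟩
      · exact Set.mem_iUnion.2 ⟨hι.some, fun h => hmK h.1⟩)
    refine ⟨s, fun x hx => ?_⟩
    obtain ⟨i, hi, hxi⟩ := Set.mem_iUnion₂.1 (hs hx.2)
    refine Set.mem_iUnion₂.2 ⟨i, hi, ?_⟩
    by_contra hc
    exact hxi ⟨hx.1, hc⟩
  · refine ⟨∅, fun x hx => ?_⟩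
    obtain ⟨i, _⟩ := Set.mem_iUnion.1 (hcov hx)
    exact (hι ⟨i⟩).elim

theorem compact_dd {X : Type*} (t : TopologicalSpace X)
    (hR : ∀ x y, SpecR t x y → SpecR t y x) {K : Set X}
    (hK : @IsCompact X t K) (hKs : IsSaturatedSet t K) :
    @IsCompact X (deGrootDual (deGrootDual t)) K := by
  classical
  refine @isCompact_generateFrom X (deGrootDual (deGrootDual t)) _ rfl K ?_
  intro P hP hcov
  by_cases hPn : P.Nonempty
  · obtain ⟨V, hV⟩ := hPn
    obtain ⟨M, hM, hMs, rfl⟩ := hP hV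
    have key : ∀ Q : Finset (Set X), (↑Q : Set (Set X)) ⊆ P →
        @IsCompact X t (K \ ⋃₀ ↑Q) ∧ IsSaturatedSet t (K \ ⋃₀ ↑Q) := by
      intro Q
      induction Q using Finset.induction_on with
      | empty => intro _; simpa using ⟨hK, hKs⟩
      | insert a Q _ ih =>
        intro hQ
        rw [Finset.coe_insert, Set.insert_subset_iff] at hQ
        obtain ⟨h1, h2⟩ := ih hQ.2
        obtain ⟨N, hN, hNs, rfl⟩ := hP hQ.1
        have e : K \ ⋃₀ ↑(insert Nᶜ Q) = (K \ ⋃₀ ↑Q) ∩ N := by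
          ext x
          simp only [Finset.coe_insert, Set.sUnion_insert, Set.mem_diff, Set.mem_union,
            Set.mem_compl_iff, Set.mem_inter_iff]
          tauto
        rw [e]
        exact ⟨compact_inter_dual t hR h1 h2 hN,
          sat_inter t h2 ((sat_dual t hR N).1 hNs)⟩
    obtain ⟨s, hs⟩ := (@isCompact_iff_finite_subcover X (deGrootDual t) M).1 hM
      (fun Q : {Q : Finset (Set X) // (↑Q : Set (Set X)) ⊆ P} => (K \ ⋃₀ ↑Q.1)ᶜ)
      (fun Q => open_dual t (key Q.1 Q.2).1 (key Q.1 Q.2).2) (by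
        intro m hm
        by_cases hmK : m ∈ K
        · obtain ⟨W, hW, hmW⟩ := hcov hmK
          refine Set.mem_iUnion.2 ⟨⟨{W}, by simpa using hW⟩, ?_⟩
          simp [hmW]
        · exact Set.mem_iUnion.2 ⟨⟨∅, by simp⟩, fun h => hmK h.1⟩)
    refine ⟨insert Mᶜ (⋃ Q ∈ s, (↑Q.1 : Set (Set X))), ?_, ?_, ?_⟩
    · refine Set.insert_subset hV (Set.iUnion₂_subset fun Q _ => Q.2)
    · exact (s.finite_toSet.biUnion fun Q _ => Q.1.finite_toSet).insert _
    · intro x hx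
      by_cases hxM : x ∈ M
      · obtain ⟨Q, hQ, hxQ⟩ := Set.mem_iUnion₂.1 (hs hxM)
        have : x ∈ ⋃₀ (↑Q.1 : Set (Set X)) := by
          by_contra hc
          exact hxQ ⟨hx, hc⟩
        obtain ⟨W, hW, hxW⟩ := this
        exact ⟨W, Or.inr (Set.mem_iUnion₂.2 ⟨Q, hQ, hW⟩), hxW⟩
      · exact ⟨Mᶜ, Or.inl rfl, hxM⟩
  · rw [Set.not_nonempty_iff_eq_empty] at hPn
    subst hPn
    exact ⟨∅, le_rfl, Set.finite_empty, hcov⟩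

theorem sym_dual {X : Type*} (t : TopologicalSpace X)
    (hR : ∀ x y, SpecR t x y → SpecR t y x) :
    ∀ x y, SpecR (deGrootDual t) x y → SpecR (deGrootDual t) y x := by
  simp only [specR_dual]
  exact fun x y h => hR _ _ h

theorem ddd_le_d {X : Type*} (t : TopologicalSpace X)
    (hR : ∀ x y, SpecR t x y → SpecR t y x) :
    deGrootDual (deGrootDual (deGrootDual t)) ≤ deGrootDual t := by
  refine le_generateFrom ?_
  rintro _ ⟨K, hK, hKs, rfl⟩
  refine open_dual _ (compact_dd t hR hK hKs) ?_
  rwa [sat_dual _ (sym_dual t hR), sat_dual t hR]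

/-- G_1 = G_{3a}: τ^{ddd} = τ iff τ^d = τ. -/
theorem ddd_eq_self_iff_d_eq_self {X : Type*} (t : TopologicalSpace X) :
    deGrootDual (deGrootDual (deGrootDual t)) = t ↔ deGrootDual t = t := by
  constructor
  · intro h
    have hR : ∀ x y, SpecR t x y → SpecR t y x := by
      intro x y hxy
      rw [← h] at hxy
      simpa only [specR_dual] using hxy
    have h1 := ddd_le_d t hR
    have h2 := ddd_le_d _ (sym_dual t hR)
    have h3 := ddd_le_d _ (sym_dual _ (sym_dual t hR))
    rw [h] at h1 h2 h3
    exact le_antisymm (h2.trans h3) h1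
  · intro h
    rw [h, h, h]
end

section
/- Let (X,τ) be a topological space with τ = τ^d. Then for every subset A ⊆ X, the upward closure of A equals the downward closure of A with respect to the specialization preorder of (X,τ): ↑A = ↓A. -/
/-- The upward closure of A in the specialization preorder: {x : x ≥ y for some y ∈ A},
where x ≥ y means y ∈ cl{x}. -/
def upClosure {X : Type*} (t : TopologicalSpace X) (A : Set X) : Set X :=
  {x | ∃ y ∈ A, y ∈ @closure X t {x}}

/-- The downward closure of A in the specialization preorder: {x : x ≤ y for some y ∈ A},
where x ≤ y means x ∈ cl{y}. -/
def downClosure {X : Type*} (t : TopologicalSpace X) (A : Set X) : Set X :=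
  {x | ∃ y ∈ A, x ∈ @closure X t {y}}

theorem selfDual_symm {X : Type*} (t : TopologicalSpace X)
    (h : t = deGrootDual t) (x y : X) (hxy : x ∈ @closure X t {y}) :
    y ∈ @closure X t {x} := by
  have hc : IsCompact (nhdsKer ({y} : Set X)) := isCompact_singleton.nhdsKer
  have hs : IsSaturatedSet t (nhdsKer ({y} : Set X)) := by
    refine ⟨{U | IsOpen U ∧ {y} ⊆ U}, fun U hU => hU.1, ?_⟩
    rw [nhdsKer_def]
  have ho : (deGrootDual t).IsOpen (nhdsKer ({y} : Set X))ᶜ :=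
    TopologicalSpace.GenerateOpen.basic _ ⟨_, hc, hs, rfl⟩
  rw [← h] at ho
  have hcl : IsClosed (nhdsKer ({y} : Set X)) := ⟨ho⟩
  have hx : x ∈ nhdsKer ({y} : Set X) :=
    closure_minimal subset_nhdsKer hcl hxy
  rw [mem_nhdsKer_singleton] at hx
  exact specializes_iff_mem_closure.1 hx

/-- Lemma 3.3: if τ = τ^d then ↑A = ↓A for every A ⊆ X. -/
theorem up_eq_down_of_selfDual {X : Type*} (t : TopologicalSpace X)
    (h : t = deGrootDual t) (A : Set X) :
    upClosure t A = downClosure t A := by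
  ext x
  exact ⟨fun ⟨y, hy, hxy⟩ => ⟨y, hy, selfDual_symm t h _ _ hxy⟩,
    fun ⟨y, hy, hxy⟩ => ⟨y, hy, selfDual_symm t h _ _ hxy⟩⟩
end

section
/- Let (X,τ) be a topological space such that ↑A = ↓A for every subset A ⊆ X (with respect to the specialization preorder of (X,τ)). If S is a compact saturated subset of (X,τ^d) and H is a closed subset of (X,τ), then S ∩ H is a compact saturated subset of (X,τ^d). -/
theorem satInter {X : Type*} {t : TopologicalSpace X} {A B : Set X}
    (hA : IsSaturatedSet t A) (hB : IsSaturatedSet t B) : IsSaturatedSet t (A ∩ B) := by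
  obtain ⟨S, hS, rfl⟩ := hA
  obtain ⟨T, hT, rfl⟩ := hB
  refine ⟨S ∪ T, ?_, (Set.sInter_union S T).symm⟩
  rintro U (hU | hU)
  · exact hS U hU
  · exact hT U hU

theorem closed_sat {X : Type*} [t : TopologicalSpace X]
    (hs : ∀ x y : X, x ∈ closure ({y} : Set X) → y ∈ closure ({x} : Set X))
    (H : Set X) (hH : IsClosed H) (r : TopologicalSpace X)
    (hr : ∀ x : X, r.IsOpen (@closure X t ({x} : Set X))ᶜ) : IsSaturatedSet r H := by
  refine ⟨{U | ∃ x, x ∉ H ∧ U = (@closure X t ({x} : Set X))ᶜ}, ?_, ?_⟩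
  · rintro U ⟨x, _, rfl⟩
    exact hr x
  · ext y
    constructor
    · rintro hy U ⟨x, hx, rfl⟩ hyx
      exact hx (@closure_minimal X t _ _ (Set.singleton_subset_iff.2 hy) hH _ (hs _ _ hyx))
    · intro hy
      by_contra hyH
      exact hy _ ⟨y, hyH, rfl⟩ (@subset_closure X t _ _ rfl)

/-- Lemma 3.4: if ↑A = ↓A for every A ⊆ X, S is compact saturated in (X,τ^d)
and H is closed in (X,τ), then S ∩ H is compact saturated in (X,τ^d). -/
theorem inter_closed_compactSaturated {X : Type*} [t : TopologicalSpace X]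
    (h : ∀ A : Set X, upClosure t A = downClosure t A)
    (S H : Set X)
    (hS₁ : @IsCompact X (deGrootDual t) S) (hS₂ : IsSaturatedSet (deGrootDual t) S)
    (hH : IsClosed H) :
    @IsCompact X (deGrootDual t) (S ∩ H) ∧ IsSaturatedSet (deGrootDual t) (S ∩ H) := by
  have hs : ∀ x y : X, x ∈ closure ({y} : Set X) → y ∈ closure ({x} : Set X) := by
    intro x y hxy
    have h1 : x ∈ downClosure t {y} := ⟨y, rfl, hxy⟩
    rw [← h] at h1
    obtain ⟨z, hz, hzx⟩ := h1
    rw [Set.mem_singleton_iff] at hz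
    exact hz ▸ hzx
  have sat : ∀ C : Set X, IsClosed C → IsSaturatedSet t C :=
    fun C hC => closed_sat hs C hC t (fun x => isClosed_closure.isOpen_compl)
  have : R0Space X := ⟨⟨fun x y hxy => by
    rw [specializes_iff_mem_closure] at hxy ⊢
    exact hs _ _ hxy⟩⟩
  have hsub : ∀ K : Set X, IsCompact K → IsSaturatedSet t K → (deGrootDual t).IsOpen Kᶜ :=
    fun K h1 h2 => TopologicalSpace.GenerateOpen.basic _ ⟨K, h1, h2, rfl⟩
  refine ⟨?_, satInter hS₂ (closed_sat hs H hH _ (fun x => hsub _ isCompact_closure_singleton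
    (sat _ isClosed_closure)))⟩
  refine @isCompact_generateFrom X (deGrootDual t) _ rfl _ ?_
  intro P hP hcov
  rcases P.eq_empty_or_nonempty with rfl | ⟨U₀, hU₀⟩
  · exact ⟨∅, subset_rfl, Set.finite_empty, hcov⟩
  obtain ⟨Q, hQP, hQ, hSQ⟩ := @IsCompact.elim_finite_subcover_image X _ (deGrootDual t) S P
    (fun U => U ∪ Hᶜ) hS₁ (by
      intro U hU
      obtain ⟨K, hK, hKs, rfl⟩ := hP hU
      have := hsub (K ∩ H) (hK.inter_right hH) (satInter hKs (sat H hH))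
      rw [Set.compl_inter] at this
      exact this) (by
      intro x hx
      rw [Set.mem_iUnion₂]
      by_cases hxH : x ∈ H
      · obtain ⟨U, hU, hxU⟩ := hcov ⟨hx, hxH⟩
        exact ⟨U, hU, Or.inl hxU⟩
      · exact ⟨U₀, hU₀, Or.inr hxH⟩)
  refine ⟨Q, hQP, hQ, ?_⟩
  rintro x ⟨hx, hxH⟩
  obtain ⟨U, hU, hxU⟩ := Set.mem_iUnion₂.1 (hSQ hx)
  exact ⟨U, hU, hxU.resolve_right (fun hn => hn hxH)⟩
end

section
/- For any topological space (X,τ): τ^{dd} = τ^d holds if and only if τ^{ddd} = τ^{dd} holds. (In the paper's notation, the classes G_{2b} and G_{3c} coincide.) -/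
open Set in
theorem dG_sat_iff {X : Type*} (s : TopologicalSpace X) (A : Set X) :
    IsSaturatedSet s A ↔ ∀ x ∈ A, ∀ y, (∀ U, s.IsOpen U → x ∈ U → y ∈ U) → y ∈ A := by
  constructor
  · rintro ⟨S, hS, rfl⟩ x hx y h U hU
    exact h U (hS U hU) (hx U hU)
  · intro h
    refine ⟨{U | s.IsOpen U ∧ A ⊆ U}, fun U hU => hU.1, ?_⟩
    apply Subset.antisymm
    · intro x hx U hU
      exact hU.2 hx
    · intro y hy
      by_contra hyA
      have key : ∀ x ∈ A, ∃ U, s.IsOpen U ∧ x ∈ U ∧ y ∉ U := by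
        intro x hx
        by_contra hc
        push Not at hc
        exact hyA (h x hx y hc)
      choose! f hf using key
      have : y ∈ ⋃₀ (f '' A) := by
        apply hy
        refine ⟨s.isOpen_sUnion _ ?_, ?_⟩
        · rintro _ ⟨x, hx, rfl⟩
          exact (hf x hx).1
        · intro x hx
          exact ⟨f x, ⟨x, hx, rfl⟩, (hf x hx).2.1⟩
      obtain ⟨_, ⟨x, hx, rfl⟩, hy'⟩ := this
      exact (hf x hx).2.2 hy'

theorem dG_open {X : Type*} (s : TopologicalSpace X) {K : Set X}
    (hK : @IsCompact X s K) (hs : IsSaturatedSet s K) : (deGrootDual s).IsOpen Kᶜ :=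
  TopologicalSpace.isOpen_generateFrom_of_mem ⟨K, hK, hs, rfl⟩

theorem dG_le {X : Type*} (s : TopologicalSpace X) (a b : X) :
    (∀ U, (deGrootDual s).IsOpen U → a ∈ U → b ∈ U) ↔ (∀ U, s.IsOpen U → b ∈ U → a ∈ U) := by
  constructor
  · intro h
    by_contra hc
    let K : Set X := {y | ∀ U, s.IsOpen U → b ∈ U → y ∈ U}
    have hbK : b ∈ K := fun U _ hb => hb
    have hKs : IsSaturatedSet s K := by
      rw [dG_sat_iff]
      intro x hx y hxy U hU hb
      exact hxy U hU (hx U hU hb)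
    have hKc : @IsCompact X s K := by
      letI := s
      apply isCompact_of_finite_subcover
      intro ι U hU hcov
      obtain ⟨i, hi⟩ := Set.mem_iUnion.1 (hcov hbK)
      refine ⟨{i}, fun y hy => ?_⟩
      simp only [Finset.mem_singleton, Set.iUnion_iUnion_eq_left]
      exact hy _ (hU i) hi
    exact h _ (dG_open s hKc hKs) hc hbK
  · intro h U hU
    change TopologicalSpace.GenerateOpen _ U at hU
    induction hU with
    | basic V hV =>
      obtain ⟨K, hK, hs, rfl⟩ := hV
      intro ha hb
      exact ha ((dG_sat_iff s K).1 hs b hb a h)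
    | univ => exact fun _ => trivial
    | inter V W _ _ h1 h2 => exact fun hx => ⟨h1 hx.1, h2 hx.2⟩
    | sUnion S _ ih =>
      rintro ⟨V, hV, ha⟩
      exact ⟨V, hV, ih V hV ha⟩

theorem dG_subcover {X : Type*} (s : TopologicalSpace X) {K : Set X} (hK : @IsCompact X s K)
    (P : Set (Set X)) (hP : ∀ U ∈ P, s.IsOpen U) (hc : K ⊆ ⋃₀ P) :
    ∃ Q ⊆ P, Q.Finite ∧ K ⊆ ⋃₀ Q := by
  letI := s
  obtain ⟨Q, h1, h2, h3⟩ := hK.elim_finite_subcover_image (b := P) (c := id) hP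
    (by simpa [Set.sUnion_eq_biUnion] using hc)
  exact ⟨Q, h1, h2, by simpa [Set.sUnion_eq_biUnion] using h3⟩

theorem dG_inter {X : Type*} (s : TopologicalSpace X) {K T : Set X} (hK : @IsCompact X s K)
    (hT : s.IsOpen Tᶜ) : @IsCompact X s (K ∩ T) := by
  letI := s
  exact hK.inter_right (isOpen_compl_iff.1 hT)

/-- If the dual is compact, closed saturated sets are compact in the dual. -/
theorem dG_closed_compact {X : Type*} (s : TopologicalSpace X)
    (hX : @IsCompact X (deGrootDual s) Set.univ) {T : Set X} (hT : s.IsOpen Tᶜ)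
    (hTs : IsSaturatedSet s T) : @IsCompact X (deGrootDual s) T := by
  letI := deGrootDual s
  apply isCompact_generateFrom (T := deGrootDual s) rfl
  intro P hP hc
  rcases T.eq_empty_or_nonempty with rfl | ⟨z, hz⟩
  · exact ⟨∅, by simp, by simp, by simp⟩
  obtain ⟨V, hVP, hzV⟩ := hc hz
  obtain ⟨Q, hQ, hQf, hQc⟩ := dG_subcover (deGrootDual s) hX ((fun U => U ∪ Tᶜ) '' P) (by
    rintro _ ⟨U, hU, rfl⟩
    obtain ⟨K, hK, hs, rfl⟩ := hP hU
    have : Kᶜ ∪ Tᶜ = (K ∩ T)ᶜ := by rw [Set.compl_inter]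
    change (deGrootDual s).IsOpen (Kᶜ ∪ Tᶜ)
    rw [this]
    refine dG_open s (dG_inter s hK hT) ?_
    rw [dG_sat_iff] at *
    exact fun x hx y h => ⟨hs x hx.1 y h, hTs x hx.2 y h⟩) (by
    intro x _
    by_cases hx : x ∈ T
    · obtain ⟨U, hU, hxU⟩ := hc hx
      exact ⟨_, ⟨U, hU, rfl⟩, Or.inl hxU⟩
    · exact ⟨_, ⟨V, hVP, rfl⟩, Or.inr hx⟩)
  obtain ⟨R, hR, hRf, rfl⟩ := Set.exists_subset_image_finite_and.1 ⟨Q, hQ, hQf, rfl⟩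
  refine ⟨R, hR, hRf, fun x hx => ?_⟩
  obtain ⟨_, ⟨U, hU, rfl⟩, h⟩ := hQc (Set.mem_univ x)
  exact ⟨U, hU, h.resolve_right (fun h => h hx)⟩

theorem dG_self {X : Type*} (s : TopologicalSpace X) (h : deGrootDual s = s) :
    @IsCompact X s Set.univ := by
  letI := s
  apply isCompact_generateFrom (T := s) h.symm
  intro P hP hc
  rcases isEmpty_or_nonempty X with hX | ⟨⟨z⟩⟩
  · exact ⟨∅, by simp, by simp, fun x => isEmptyElim x⟩
  obtain ⟨V, hVP, hzV⟩ := hc (Set.mem_univ z)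
  obtain ⟨K, hK, hs, rfl⟩ := hP hVP
  obtain ⟨Q, hQ, hQf, hQc⟩ := dG_subcover s hK P (by
    intro U hU
    obtain ⟨L, hL, hs, rfl⟩ := hP hU
    have := dG_open s hL hs
    rwa [h] at this) (fun x _ => hc (Set.mem_univ x))
  refine ⟨insert Kᶜ Q, Set.insert_subset hVP hQ, hQf.insert _, fun x _ => ?_⟩
  by_cases hx : x ∈ K
  · obtain ⟨U, hU, h⟩ := hQc hx
    exact ⟨U, Or.inr hU, h⟩
  · exact ⟨_, Or.inl rfl, hx⟩

/-- Compactness passes to coarser topologies. -/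
theorem dG_coarser {X : Type*} (s t : TopologicalSpace X) (h : s ≤ t) {K : Set X}
    (hK : @IsCompact X s K) : @IsCompact X t K := by
  have := @IsCompact.image X X s t K id hK (continuous_id_iff_le.2 h)
  simpa using this

theorem G2b_eq_G3c {X : Type*} (t : TopologicalSpace X) :
    deGrootDual (deGrootDual t) = deGrootDual t ↔
      deGrootDual (deGrootDual (deGrootDual t)) = deGrootDual (deGrootDual t) := by
  constructor
  · intro h
    rw [h, h]
  intro h
  have e1 := dG_le t
  have e2 := dG_le (deGrootDual t)
  have e3 := dG_le (deGrootDual (deGrootDual t))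
  rw [h] at e3
  -- the specialization preorder of `t` is symmetric
  have hsym : ∀ a b : X, (∀ U, t.IsOpen U → a ∈ U → b ∈ U) →
      (∀ U, t.IsOpen U → b ∈ U → a ∈ U) := by
    intro a b hab
    exact (e1 a b).1 ((e2 b a).1 ((e3 b a).2 ((e2 a b).2 ((e1 b a).2 hab))))
  have s1 : ∀ A, IsSaturatedSet (deGrootDual t) A ↔ IsSaturatedSet t A := by
    intro A
    rw [dG_sat_iff, dG_sat_iff]
    exact ⟨fun H x hx y hy => H x hx y ((e1 x y).2 (hsym _ _ hy)),
      fun H x hx y hy => H x hx y (hsym _ _ ((e1 x y).1 hy))⟩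
  have s2 : ∀ A, IsSaturatedSet (deGrootDual (deGrootDual t)) A ↔ IsSaturatedSet t A := by
    intro A
    rw [dG_sat_iff, dG_sat_iff]
    exact ⟨fun H x hx y hy => H x hx y ((e2 x y).2 ((e1 y x).2 hy)),
      fun H x hx y hy => H x hx y ((e1 y x).1 ((e2 x y).1 hy))⟩
  have c0 : ∀ T : Set X, t.IsOpen Tᶜ → IsSaturatedSet t T := by
    intro T hT
    rw [dG_sat_iff]
    intro x hx y hxy
    by_contra hy
    exact hsym _ _ hxy _ hT hy hx
  have hX2 : @IsCompact X (deGrootDual (deGrootDual t)) Set.univ := dG_self _ h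
  -- the second dual is finer than the first one
  have h21 : deGrootDual (deGrootDual t) ≤ deGrootDual t := by
    conv_rhs => rw [deGrootDual]
    rw [TopologicalSpace.le_generateFrom_iff_subset_isOpen]
    rintro _ ⟨K, hK, hs, rfl⟩
    have hc := dG_closed_compact (deGrootDual t) hX2 (dG_open t hK hs) ((s1 K).2 hs)
    have := dG_open _ hc ((s2 K).2 hs)
    rw [h] at this
    exact this
  have hX1 : @IsCompact X (deGrootDual t) Set.univ := dG_coarser _ _ h21 hX2
  have h20 : deGrootDual (deGrootDual t) ≤ t := by
    intro U hU
    have hU' : t.IsOpen Uᶜᶜ := by rw [compl_compl]; exact hU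
    have hc := dG_closed_compact t hX1 hU' (c0 _ hU')
    have := dG_open _ hc ((s1 _).2 (c0 _ hU'))
    rw [compl_compl] at this
    exact this
  refine le_antisymm h21 ?_
  conv_rhs => rw [deGrootDual]
  rw [TopologicalSpace.le_generateFrom_iff_subset_isOpen]
  rintro _ ⟨K, hK, hs, rfl⟩
  have hc := dG_inter _ hX2 (dG_open _ hK hs)
  rw [Set.univ_inter] at hc
  exact dG_open t (dG_coarser _ _ h20 hc) ((s1 K).1 hs)
end

section
/- Let (X,τ) be a compact Hausdorff topological space. Then the dual topology coincides with the original topology: τ^d = τ (i.e., every compact T_2 space belongs to the class G_1). -/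
/-- Example 4.1: every compact T₂ space belongs to the class G_1, i.e. τ^d = τ. -/
theorem compact_t2_selfDual {X : Type*} [t : TopologicalSpace X]
    [CompactSpace X] [T2Space X] :
    deGrootDual t = t := by
  apply le_antisymm
  · intro U hU
    apply TopologicalSpace.isOpen_generateFrom_of_mem
    have hU' : IsOpen U := hU
    refine ⟨Uᶜ, hU'.isClosed_compl.isCompact, ?_, (compl_compl U).symm⟩
    refine ⟨{V | ∃ x ∈ U, V = {x}ᶜ}, ?_, ?_⟩
    · rintro V ⟨x, -, rfl⟩
      exact (isOpen_compl_singleton : IsOpen ({x}ᶜ : Set X))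
    · ext y
      constructor
      · rintro hy V ⟨x, hx, rfl⟩ h
        rw [Set.mem_singleton_iff] at h
        subst h
        exact hy hx
      · intro h hy
        exact h {y}ᶜ ⟨y, hy, rfl⟩ rfl
  · apply le_generateFrom
    rintro U ⟨K, hK, -, rfl⟩
    exact hK.isClosed.isOpen_compl
end

section
/- Let (X,τ) be a Hausdorff k-space (compactly generated: a set is closed iff its intersection with every compact set is closed in that compact set) which is not compact. Then τ^{dd} = τ but τ^d ≠ τ; that is, (X,τ) belongs to the class G_{2a} but not to the class G_1. -/
theorem aux_sat {X : Type*} (t : TopologicalSpace X)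
    (h : ∀ x : X, t.IsOpen ({x}ᶜ)) (A : Set X) : IsSaturatedSet t A := by
  refine ⟨{U | ∃ x, x ∉ A ∧ U = {x}ᶜ}, ?_, ?_⟩
  · rintro U ⟨x, -, rfl⟩
    exact h x
  · ext y
    constructor
    · rintro hy U ⟨x, hx, rfl⟩ rfl
      exact hx hy
    · intro hy
      by_contra hyA
      exact hy {y}ᶜ ⟨y, hyA, rfl⟩ rfl

theorem aux_sat_t2 {X : Type*} [t : TopologicalSpace X] [T2Space X] (A : Set X) :
    IsSaturatedSet t A :=
  aux_sat t (fun _ => isOpen_compl_singleton) A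

theorem aux_open {X : Type*} [t : TopologicalSpace X] [T2Space X] {K : Set X}
    (hK : IsCompact K) : (deGrootDual t).IsOpen Kᶜ :=
  TopologicalSpace.isOpen_generateFrom_of_mem ⟨K, hK, aux_sat_t2 K, rfl⟩

theorem aux_compact {X : Type*} [t : TopologicalSpace X] [T2Space X] {A : Set X}
    (hA : IsClosed A) : @IsCompact X (deGrootDual t) A := by
  refine @isCompact_generateFrom X (deGrootDual t) _ rfl A ?_
  intro P hP hcov
  rcases A.eq_empty_or_nonempty with rfl | ⟨a, ha⟩
  · exact ⟨∅, by simp, by simp, by simp⟩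
  obtain ⟨U, hU, -⟩ := hcov ha
  obtain ⟨K, hK, -, rfl⟩ := hP hU
  have hc : IsCompact (A ∩ K) := hK.inter_left hA
  obtain ⟨Q, hQP, hQf, hQ⟩ := hc.elim_finite_subcover_image (b := P) (c := id) (by
    intro V hV
    obtain ⟨L, hL, -, rfl⟩ := hP hV
    exact hL.isClosed.isOpen_compl) (fun x hx => by simpa using hcov hx.1)
  refine ⟨insert Kᶜ Q, Set.insert_subset hU hQP, hQf.insert _, ?_⟩
  intro x hx
  by_cases hxK : x ∈ K
  · obtain ⟨V, hV, hxV⟩ := Set.mem_iUnion₂.1 (hQ ⟨hx, hxK⟩)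
    exact ⟨V, Or.inr hV, hxV⟩
  · exact ⟨Kᶜ, Or.inl rfl, hxK⟩

theorem aux_inter {X : Type*} [t : TopologicalSpace X] [T2Space X] {A K : Set X}
    (hA : @IsCompact X (deGrootDual t) A) (hK : IsCompact K) : IsCompact (A ∩ K) := by
  have hAK : @IsCompact X (deGrootDual t) (A ∩ K) :=
    @IsCompact.inter_right X (deGrootDual t) A K hA
      (@IsClosed.mk X (deGrootDual t) K (aux_open hK))
  refine isCompact_of_finite_subcover ?_
  intro ι U hU hcov
  obtain ⟨s, hs⟩ := @IsCompact.elim_finite_subcover X (deGrootDual t) _ ι hAK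
    (fun i => (K \ U i)ᶜ) (fun i => aux_open (hK.diff (hU i))) (by
      intro x hx
      obtain ⟨i, hi⟩ := Set.mem_iUnion.1 (hcov hx)
      exact Set.mem_iUnion.2 ⟨i, fun h => h.2 hi⟩)
  refine ⟨s, fun x hx => ?_⟩
  have h := hs hx
  simp only [Set.mem_iUnion] at h ⊢
  obtain ⟨i, hi, hxi⟩ := h
  refine ⟨i, hi, ?_⟩
  by_contra hn
  exact hxi ⟨hx.2, hn⟩

/-- Example 4.2: every non-compact Hausdorff k-space belongs to G_{2a} but not to G_1:
τ^{dd} = τ but τ^d ≠ τ. -/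
theorem noncompact_t2_kspace_G2a {X : Type*} [t : TopologicalSpace X] [T2Space X]
    (hk : ∀ A : Set X, IsClosed A ↔
      ∀ K : Set X, IsCompact K → IsClosed ((Subtype.val : K → X) ⁻¹' A))
    (hnc : ¬ CompactSpace X) :
    deGrootDual (deGrootDual t) = t ∧ deGrootDual t ≠ t := by
  constructor
  · apply le_antisymm
    · intro U hU
      have hc : @IsCompact X (deGrootDual t) Uᶜ :=
        aux_compact (t := t) (isClosed_compl_iff.2 hU)
      exact TopologicalSpace.isOpen_generateFrom_of_mem ⟨Uᶜ, hc,
        aux_sat _ (fun x => aux_open (t := t) isCompact_singleton) _, (compl_compl U).symm⟩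
    · refine le_generateFrom ?_
      rintro U ⟨A, hA, -, rfl⟩
      have : IsClosed A := by
        rw [hk]
        intro K hK
        have h := (aux_inter hA hK).isClosed.preimage (continuous_subtype_val (p := (· ∈ K)))
        convert h using 1
        ext x
        simp
      exact this.isOpen_compl
  · intro h
    apply hnc
    have hc := aux_compact (t := t) isClosed_univ
    rw [h] at hc
    exact ⟨hc⟩
end
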